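/- Min-entropy operator lemma. Let ξ be a positive semidefinite matrix on ℂ^{d_A} ⊗ ℂ^{d_R} with 0 < tr ξ, let ζ be a positive semidefinite d_R×d_R matrix with tr ζ = 1, and let λ ∈ ℝ be such that ξ ≤ 2^{−λ} (1_A ⊗ ζ) in the Loewner order. Then tr[ ((1_A ⊗ ζ^{−1/2}) ξ)² ] ≤ 2^{−λ} · tr ξ, where ζ^{−1/2} denotes the square root of the Moore–Penrose pseudoinverse of ζ (inverse on the support of ζ). -/

import Mathlib

open Matrix
open scoped Kronecker ComplexOrder

/-- Square root of the Moore–Penrose pseudoinverse of a Hermitian matrix: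
`ζ^{−1/2} := Σ_{k: μ_k > 0} μ_k^{−1/2} |e_k⟩⟨e_k|` (junk value `0` if not Hermitian). -/
noncomputable def pinvSqrt {n : Type*} [Fintype n] [DecidableEq n]
    (M : Matrix n n ℂ) : Matrix n n ℂ :=
  letI := Classical.dec M.IsHermitian
  if h : M.IsHermitian then
    (h.eigenvectorUnitary : Matrix n n ℂ) *
      Matrix.diagonal (fun i =>
        if 0 < h.eigenvalues i then (((Real.sqrt (h.eigenvalues i))⁻¹ : ℝ) : ℂ) else 0) *
      (star h.eigenvectorUnitary : Matrix n n ℂ)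
  else 0

/-- The trace of a product of two positive semidefinite matrices has nonnegative real part. -/
theorem Matrix.PosSemidef.re_trace_mul_nonneg {n : Type*} [Fintype n]
    {A B : Matrix n n ℂ} (hA : A.PosSemidef) (hB : B.PosSemidef) : 0 ≤ (A * B).trace.re := by
  classical
  obtain ⟨C, rfl⟩ : ∃ C : Matrix n n ℂ, B = Cᴴ * C := by
    open scoped MatrixOrder in
    exact CStarAlgebra.nonneg_iff_eq_star_mul_self.mp hB.nonneg
  rw [← Matrix.mul_assoc, Matrix.trace_mul_comm, ← Matrix.mul_assoc]
  exact (Complex.nonneg_iff.mp (hA.mul_mul_conjTranspose_same C).trace_nonneg).1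

theorem isHermitian_pinvSqrt {n : Type*} [Fintype n] [DecidableEq n] (M : Matrix n n ℂ) :
    (pinvSqrt M).IsHermitian := by
  unfold pinvSqrt
  split_ifs with h
  · refine isHermitian_mul_mul_conjTranspose _ (isHermitian_diagonal_of_self_adjoint _ ?_)
    ext i
    by_cases hi : 0 < h.eigenvalues i <;> simp [hi]
  · exact isHermitian_zero

/-- `ζ^{−1/2} ζ ζ^{−1/2}` is the support projection of `ζ`, hence at most `1`. -/
theorem posSemidef_one_sub_pinvSqrt_mul_mul_pinvSqrt {n : Type*} [Fintype n] [DecidableEq n]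
    {M : Matrix n n ℂ} (hM : M.IsHermitian) :
    (1 - pinvSqrt M * M * pinvSqrt M).PosSemidef := by
  set U : Matrix n n ℂ := (hM.eigenvectorUnitary : Matrix n n ℂ) with hU
  have hUU : star U * U = 1 := Unitary.coe_star_mul_self hM.eigenvectorUnitary
  have hUU' : U * star U = 1 := Unitary.coe_mul_star_self hM.eigenvectorUnitary
  set s : n → ℂ := fun i =>
    if 0 < hM.eigenvalues i then (((Real.sqrt (hM.eigenvalues i))⁻¹ : ℝ) : ℂ) else 0 with hs
  set μ : n → ℂ := fun i => (hM.eigenvalues i : ℂ) with hμ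
  have hS : pinvSqrt M = U * diagonal s * star U := by
    simp [pinvSqrt, hM, hU, hs]
  have hspec : M = U * diagonal μ * star U := by
    conv_lhs => rw [hM.spectral_theorem, Unitary.conjStarAlgAut_apply]
    rfl
  have key : 1 - pinvSqrt M * M * pinvSqrt M
      = U * diagonal (fun i => 1 - s i * μ i * s i) * star U := by
    have hprod : pinvSqrt M * M * pinvSqrt M
        = U * diagonal (fun i => s i * μ i * s i) * star U := by
      rw [hS]
      nth_rewrite 1 [hspec]
      calc U * diagonal s * star U * (U * diagonal μ * star U) * (U * diagonal s * star U)
          = U * diagonal s * (star U * U) * diagonal μ * (star U * U) * diagonal s * star U := by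
            simp only [Matrix.mul_assoc]
        _ = U * (diagonal s * diagonal μ * diagonal s) * star U := by
            simp only [hUU, Matrix.mul_one, Matrix.mul_assoc]
        _ = _ := by simp only [diagonal_mul_diagonal]
    have hdiag : diagonal (fun i => 1 - s i * μ i * s i)
        = (1 : Matrix n n ℂ) - diagonal (fun i => s i * μ i * s i) := by
      rw [← diagonal_one, diagonal_sub]
    rw [hprod, hdiag, Matrix.mul_sub, Matrix.sub_mul, Matrix.mul_one, hUU']
  rw [key]
  refine PosSemidef.mul_mul_conjTranspose_same (PosSemidef.diagonal fun i => ?_) U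
  by_cases h : 0 < hM.eigenvalues i
  · have hreal : (√(hM.eigenvalues i))⁻¹ * hM.eigenvalues i * (√(hM.eigenvalues i))⁻¹ = 1 := by
      have := Real.sqrt_pos.mpr h
      field_simp
      exact (Real.sq_sqrt h.le).symm
    have hone : s i * μ i * s i = 1 := by
      simp only [hs, hμ, h, if_true]
      exact_mod_cast hreal
    simp [hone]
  · simp [hs, h]

/-- **Min-entropy operator lemma.** If `ξ ≤ 2^{−λ} (1_A ⊗ ζ)` then
`tr[((1⊗ζ^{−1/2})ξ)²] ≤ 2^{−λ} tr ξ`. -/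
theorem min_entropy_operator_lemma
    (dA dR : ℕ)
    (ξ : Matrix (Fin dA × Fin dR) (Fin dA × Fin dR) ℂ)
    (hξ : ξ.PosSemidef) (hξtr : 0 < ξ.trace.re)
    (ζ : Matrix (Fin dR) (Fin dR) ℂ) (hζ : ζ.PosSemidef) (hζtr : ζ.trace = 1)
    (lam : ℝ)
    (hle : (((2 : ℝ) ^ (-lam)) • ((1 : Matrix (Fin dA) (Fin dA) ℂ) ⊗ₖ ζ) - ξ).PosSemidef) :
    ((((1 : Matrix (Fin dA) (Fin dA) ℂ) ⊗ₖ pinvSqrt ζ) * ξ *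
        ((1 : Matrix (Fin dA) (Fin dA) ℂ) ⊗ₖ pinvSqrt ζ) * ξ).trace).re
      ≤ (2 : ℝ) ^ (-lam) * ξ.trace.re := by
  set c : ℝ := (2 : ℝ) ^ (-lam)
  have hc : 0 ≤ c := Real.rpow_nonneg zero_le_two _
  set Z := (1 : Matrix (Fin dA) (Fin dA) ℂ) ⊗ₖ ζ with hZ
  set S := (1 : Matrix (Fin dA) (Fin dA) ℂ) ⊗ₖ pinvSqrt ζ with hS
  have hSH : Sᴴ = S := by
    rw [hS, conjTranspose_kronecker, conjTranspose_one, (isHermitian_pinvSqrt ζ).eq]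
  have hproj : (1 - S * Z * S).PosSemidef := by
    have h := (PosSemidef.one (n := Fin dA) (R := ℂ)).kronecker
      (posSemidef_one_sub_pinvSqrt_mul_mul_pinvSqrt hζ.isHermitian)
    have heq : (1 : Matrix (Fin dA) (Fin dA) ℂ) ⊗ₖ (1 - pinvSqrt ζ * ζ * pinvSqrt ζ)
        = 1 - S * Z * S := by
      rw [hS, hZ, ← mul_kronecker_mul, ← mul_kronecker_mul, Matrix.one_mul, Matrix.one_mul,
        eq_sub_iff_add_eq, ← kronecker_add, sub_add_cancel, one_kronecker_one]
    rwa [heq] at h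
  have hconj : (S * (c • Z - ξ) * S).PosSemidef := by
    simpa only [hSH] using hle.mul_mul_conjTranspose_same S
  have hbound := hconj.re_trace_mul_nonneg hξ
  have hsupp := mul_nonneg hc (hproj.re_trace_mul_nonneg hξ)
  simp only [Matrix.mul_sub, Matrix.sub_mul, Matrix.mul_smul, Matrix.smul_mul, Matrix.one_mul,
    trace_sub, trace_smul, Complex.sub_re, Complex.real_smul, Complex.re_ofReal_mul]
    at hbound hsupp
  linarith
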